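/- For each ρ ∈ (0,1), the sequence n ↦ Q_n(ρ) = ((1−ρ^{n+1})/(1−ρ))·R*_n(ρ)/ρ^n is non-decreasing in n ∈ ℕ. -/

import Mathlib

/-- `V_ρ(r) = min_{β ∈ [0,1]} (1 - β + ρβ² + ρβ(r-1))`. -/
noncomputable def Vq (ρ r : ℝ) : ℝ :=
  sInf ((fun b : ℝ => 1 - b + ρ * b ^ 2 + ρ * b * (r - 1)) '' Set.Icc 0 1)

/-- The minimax-optimal bounds: `R*₀ = 1`, `R*_n = V_ρ(R*_{n-1})`. -/
noncomputable def RStar (ρ : ℝ) : ℕ → ℝ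
  | 0 => 1
  | n + 1 => Vq ρ (RStar ρ n)

lemma nonneg_of_mem_image_objective {ρ r : ℝ} (h0 : 0 < ρ) (h1 : ρ < 1) (hr : 0 ≤ r) :
    ∀ y ∈ (fun b : ℝ => 1 - b + ρ * b ^ 2 + ρ * b * (r - 1)) '' Set.Icc 0 1, 0 ≤ y := by
  rintro y ⟨b, ⟨hb0, hb1⟩, rfl⟩
  have hb : ρ * b ≤ 1 := mul_le_one₀ h1.le hb0 hb1
  have h2 := mul_nonneg (sub_nonneg.2 hb1) (sub_nonneg.2 hb)
  have h3 : 0 ≤ ρ * b * r := by positivity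
  dsimp only
  linarith

lemma Vq_le {ρ r b : ℝ} (h0 : 0 < ρ) (h1 : ρ < 1) (hr : 0 ≤ r) (hb : b ∈ Set.Icc (0 : ℝ) 1) :
    Vq ρ r ≤ 1 - b + ρ * b ^ 2 + ρ * b * (r - 1) :=
  csInf_le ⟨0, nonneg_of_mem_image_objective h0 h1 hr⟩ ⟨b, hb, rfl⟩

lemma le_Vq {ρ r c : ℝ}
    (h : ∀ b ∈ Set.Icc (0 : ℝ) 1, c ≤ 1 - b + ρ * b ^ 2 + ρ * b * (r - 1)) : c ≤ Vq ρ r := by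
  refine le_csInf ((Set.nonempty_Icc.2 zero_le_one).image _) ?_
  rintro y ⟨b, hb, rfl⟩
  exact h b hb

lemma Vq_nonneg {ρ r : ℝ} (h0 : 0 < ρ) (h1 : ρ < 1) (hr : 0 ≤ r) : 0 ≤ Vq ρ r :=
  le_Vq fun b hb => nonneg_of_mem_image_objective h0 h1 hr _ ⟨b, hb, rfl⟩

lemma Vq_le_mul {ρ r : ℝ} (h0 : 0 < ρ) (h1 : ρ < 1) (hr : 0 ≤ r) : Vq ρ r ≤ ρ * r := by
  have := Vq_le h0 h1 hr (b := 1) (by simp)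
  linarith

lemma Vq_eq_of_lt {ρ r : ℝ} (h0 : 0 < ρ) (h1 : ρ < 1) (hr : 0 ≤ r) (h : ρ * r < 1 - ρ) :
    Vq ρ r = ρ * r := by
  refine (Vq_le_mul h0 h1 hr).antisymm (le_Vq fun b ⟨_, hb1⟩ => ?_)
  have h2 := mul_nonneg (sub_nonneg.2 hb1) (sub_nonneg.2 h.le)
  have h3 := mul_nonneg h0.le (sq_nonneg (1 - b))
  linarith

lemma Vq_eq_of_le {ρ r : ℝ} (h0 : 0 < ρ) (h1 : ρ < 1) (h : 1 - ρ ≤ ρ * r)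
    (hr : r ≤ 1) : Vq ρ r = ρ * r - (ρ * r - (1 - ρ)) ^ 2 / (4 * ρ) := by
  have hr0 : 0 ≤ r := by
    by_contra! hneg
    linarith [mul_neg_of_pos_of_neg h0 hneg]
  have key (b : ℝ) : 1 - b + ρ * b ^ 2 + ρ * b * (r - 1) =
      ρ * r - (ρ * r - (1 - ρ)) ^ 2 / (4 * ρ) + ρ * (b - (1 + ρ - ρ * r) / (2 * ρ)) ^ 2 := by
    field_simp
    ring
  refine le_antisymm ?_ (le_Vq fun b _ => ?_)
  · have hb : (1 + ρ - ρ * r) / (2 * ρ) ∈ Set.Icc (0 : ℝ) 1 := by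
      constructor
      · apply div_nonneg <;> nlinarith
      · rw [div_le_one (by positivity)]
        linarith
    have := Vq_le h0 h1 hr0 hb
    rw [key, sub_self] at this
    linarith
  · rw [key]
    have : 0 ≤ ρ * (b - (1 + ρ - ρ * r) / (2 * ρ)) ^ 2 := by positivity
    linarith

lemma RStar_nonneg {ρ : ℝ} (h0 : 0 < ρ) (h1 : ρ < 1) (n : ℕ) : 0 ≤ RStar ρ n := by
  induction n with
  | zero => exact zero_le_one
  | succ n ih => exact Vq_nonneg h0 h1 ih

lemma RStar_le_one {ρ : ℝ} (h0 : 0 < ρ) (h1 : ρ < 1) (n : ℕ) : RStar ρ n ≤ 1 := by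
  induction n with
  | zero => exact le_rfl
  | succ n ih =>
    exact (Vq_le_mul h0 h1 (RStar_nonneg h0 h1 n)).trans
      (mul_le_one₀ h1.le (RStar_nonneg h0 h1 n) ih)

/-- In the quadratic regime `x = (ρ R*_n + 1 - ρ) / 4` follows the logistic map `x ↦ x - x²`,
which forces `x ≤ 1 / (n + 4)`. -/
lemma RStar_lt_or_le {ρ : ℝ} (h0 : 0 < ρ) (h1 : ρ < 1) (n : ℕ) :
    ρ * RStar ρ n < 1 - ρ ∨ (ρ * RStar ρ n + (1 - ρ)) / 4 ≤ 1 / ((n : ℝ) + 4) := by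
  induction n with
  | zero => right; simp [RStar]
  | succ n ih =>
    have hr := RStar_nonneg h0 h1 n
    change ρ * Vq ρ (RStar ρ n) < 1 - ρ ∨ (ρ * Vq ρ (RStar ρ n) + (1 - ρ)) / 4 ≤ _
    rcases lt_or_ge (ρ * RStar ρ n) (1 - ρ) with h | h
    · left
      rw [Vq_eq_of_lt h0 h1 hr h]
      have : 0 ≤ ρ * RStar ρ n := by positivity
      nlinarith
    · right
      have hx := ih.resolve_left h.not_gt
      rw [Vq_eq_of_le h0 h1 h (RStar_le_one h0 h1 n)]
      set x := (ρ * RStar ρ n + (1 - ρ)) / 4 with hxdef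
      have hrx : ρ * RStar ρ n = 4 * x - (1 - ρ) := by rw [hxdef]; ring
      have hstep : (ρ * (ρ * RStar ρ n - (ρ * RStar ρ n - (1 - ρ)) ^ 2 / (4 * ρ)) + (1 - ρ)) / 4
          = x - x ^ 2 := by
        rw [hrx]
        field_simp
        ring
      rw [hstep]
      have hn : (0 : ℝ) ≤ n := n.cast_nonneg
      have hy : 1 / ((n : ℝ) + 4) ≤ 1 / 4 := by gcongr; linarith
      have hmono : x - x ^ 2 ≤ 1 / ((n : ℝ) + 4) - (1 / ((n : ℝ) + 4)) ^ 2 := by nlinarith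
      refine hmono.trans ?_
      push_cast
      rw [← sub_nonneg]
      have : 1 / ((n : ℝ) + 1 + 4) - (1 / ((n : ℝ) + 4) - (1 / ((n : ℝ) + 4)) ^ 2)
          = 1 / (((n : ℝ) + 1 + 4) * ((n : ℝ) + 4) ^ 2) := by
        field_simp
        ring
      rw [this]
      positivity

lemma two_mul_one_sub_pow_le {q : ℝ} (h0 : 0 ≤ q) (h1 : q ≤ 1) (n : ℕ) :
    2 * (1 - q ^ (n + 2)) ≤ ((n : ℝ) + 2) * (1 - q ^ 2) := by
  induction n with
  | zero => simp
  | succ n ih =>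
    have hq : q ^ (n + 2) ≤ q := by
      simpa using pow_le_pow_of_le_one h0 h1 (show 1 ≤ n + 2 by omega)
    have h2 := mul_nonneg (sub_nonneg.2 hq) (sub_nonneg.2 h1)
    have h3 : q ^ (n + 1 + 2) = q ^ (n + 2) * q := by ring
    rw [h3]
    push_cast
    nlinarith [sq_nonneg (1 - q)]

lemma mul_RStar_le_mul_RStar_succ {ρ : ℝ} (h0 : 0 < ρ) (h1 : ρ < 1) (n : ℕ) :
    (1 - ρ ^ (n + 1)) * (ρ * RStar ρ n) ≤ (1 - ρ ^ (n + 2)) * RStar ρ (n + 1) := by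
  have hr := RStar_nonneg h0 h1 n
  change _ ≤ _ * Vq ρ (RStar ρ n)
  rcases lt_or_ge (ρ * RStar ρ n) (1 - ρ) with h | h
  · rw [Vq_eq_of_lt h0 h1 hr h]
    have : ρ ^ (n + 2) ≤ ρ ^ (n + 1) := pow_le_pow_of_le_one h0.le h1.le (by omega)
    gcongr
  · have hx := (RStar_lt_or_le h0 h1 n).resolve_left h.not_gt
    rw [Vq_eq_of_le h0 h1 h (RStar_le_one h0 h1 n)]
    set x := (ρ * RStar ρ n + (1 - ρ)) / 4 with hxdef
    have hrx : ρ * RStar ρ n = 4 * x - (1 - ρ) := by rw [hxdef]; ring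
    rw [hrx] at h ⊢
    obtain ⟨q, hq0, rfl⟩ : ∃ q : ℝ, 0 ≤ q ∧ ρ = q ^ 2 :=
      ⟨√ρ, Real.sqrt_nonneg ρ, (Real.sq_sqrt h0.le).symm⟩
    have hq1 : q ≤ 1 := by nlinarith
    have hB := two_mul_one_sub_pow_le hq0 hq1 n
    have hn : (0 : ℝ) ≤ n := n.cast_nonneg
    have hx0 : 0 ≤ x := by linarith
    have hxn : x * ((n : ℝ) + 4) ≤ 1 := by rwa [le_div_iff₀ (by positivity)] at hx
    have hlin : 2 * x - (1 - q ^ 2) ≤ 2 * x * q ^ (n + 2) := by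
      have h2 := mul_le_mul_of_nonneg_left hB hx0
      have h3 := mul_le_mul_of_nonneg_right hxn (sub_nonneg.2 h1.le)
      have h4 := mul_nonneg hx0 (sub_nonneg.2 h1.le)
      linarith
    have hsq : (2 * x - (1 - q ^ 2)) ^ 2 ≤ 4 * x ^ 2 * (q ^ 2) ^ (n + 2) := by
      calc (2 * x - (1 - q ^ 2)) ^ 2 ≤ (2 * x * q ^ (n + 2)) ^ 2 :=
            pow_le_pow_left₀ (by linarith) hlin 2
        _ = _ := by ring
    rw [← sub_nonneg]
    have hdiff : (1 - (q ^ 2) ^ (n + 2)) *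
          (4 * x - (1 - q ^ 2) - (4 * x - (1 - q ^ 2) - (1 - q ^ 2)) ^ 2 / (4 * q ^ 2)) -
          (1 - (q ^ 2) ^ (n + 1)) * (4 * x - (1 - q ^ 2)) =
        (4 * x ^ 2 * (q ^ 2) ^ (n + 2) - (2 * x - (1 - q ^ 2)) ^ 2) / q ^ 2 := by
      have : q ≠ 0 := by rintro rfl; simp at h0
      field_simp
      ring
    rw [hdiff]
    exact div_nonneg (sub_nonneg.2 hsq) h0.le

/-- for each `ρ ∈ (0,1)` the sequence
`Q_n(ρ) = ((1-ρ^{n+1})/(1-ρ)) · R*_n(ρ)/ρ^n` is non-decreasing in `n`. -/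
theorem Qn_monotone (ρ : ℝ) (hρ : ρ ∈ Set.Ioo (0 : ℝ) 1) :
    Monotone (fun n : ℕ => (1 - ρ ^ (n + 1)) / (1 - ρ) * RStar ρ n / ρ ^ n) := by
  obtain ⟨h0, h1⟩ := hρ
  have ha : 0 < 1 - ρ := sub_pos.2 h1
  refine monotone_nat_of_le_succ fun n => ?_
  calc (1 - ρ ^ (n + 1)) / (1 - ρ) * RStar ρ n / ρ ^ n
      = (1 - ρ ^ (n + 1)) * (ρ * RStar ρ n) / ((1 - ρ) * ρ ^ (n + 1)) := by
        field_simp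
        ring
    _ ≤ (1 - ρ ^ (n + 2)) * RStar ρ (n + 1) / ((1 - ρ) * ρ ^ (n + 1)) := by
        exact div_le_div_of_nonneg_right (mul_RStar_le_mul_RStar_succ h0 h1 n) (by positivity)
    _ = (1 - ρ ^ (n + 1 + 1)) / (1 - ρ) * RStar ρ (n + 1) / ρ ^ (n + 1) := by
        field_simp
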